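/- arXiv:math/0606074 — 2 statements merged into one kernel-verified Lean document; each statement's English description precedes it below -/
import Mathlib

section
/- Let K be a field of characteristic 2 and V a K-vector space of dimension 2m with symplectic basis x_1,y_1,...,x_m,y_m, and let DV be its divided power algebra with differential ∂ given by multiplication by ω = x_1y_1 + ... + x_my_m. Then for every integer k ≥ 0, the cohomology module H^k(DV) = ker ∂_k / Im ∂_{k−2} is zero if and only if k < m or k ≢ m (mod 2). -/
noncomputable section

open Finsupp TensorProduct

/-- The underlying space of the divided power algebra `DV` of a vector space `V` with basis
indexed by `ι`: the free `K`-module on the set of multi-indices, where a multi-index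
`a : ι →₀ ℕ` corresponds to the basis monomial `∏ᵢ vᵢ^{(a i)}`. -/
abbrev DPA (K ι : Type) [Field K] := (ι →₀ ℕ) →₀ K

/-- Total degree of a multi-index. -/
def deg {ι : Type} (a : ι →₀ ℕ) : ℕ := a.sum fun _ e => e

/-- The degree-`k` homogeneous component `D_k V` of the divided power algebra. -/
def Dsub (K ι : Type) [Field K] (k : ℕ) : Submodule K (DPA K ι) :=
  Submodule.span K {f | ∃ a : ι →₀ ℕ, deg a = k ∧ f = Finsupp.single a (1 : K)}

/-- The structure constant of the divided power algebra:
`(∏ᵢ vᵢ^{(a i)}) ⬝ (∏ᵢ vᵢ^{(b i)}) = (∏ᵢ C(a i + b i, a i)) • ∏ᵢ vᵢ^{(a i + b i)}`. -/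
def dpCoef {ι : Type} (a b : ι →₀ ℕ) : ℕ :=
  (a + b).prod fun i _ => Nat.choose (a i + b i) (a i)

/-- Multiplication of the divided power algebra, as a bilinear map. -/
def dpMul (K ι : Type) [Field K] : DPA K ι →ₗ[K] DPA K ι →ₗ[K] DPA K ι :=
  Finsupp.lsum K fun a => LinearMap.toSpanSingleton K _
    (Finsupp.lsum K fun b => LinearMap.toSpanSingleton K _
      ((dpCoef a b : K) • Finsupp.single (a + b) (1 : K)))

/-- Divided power `w^{(n)} ∈ D_n V` of a vector `w = ∑ᵢ wᵢ vᵢ ∈ V`; it is determined by the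
rules `(u+v)^{(a)} = ∑ u^{(i)} v^{(a-i)}` and `(t u)^{(a)} = tᵃ u^{(a)}`. -/
def dpow {K ι : Type} [Field K] [Fintype ι] [DecidableEq ι] (w : ι → K) (n : ℕ) : DPA K ι :=
  ∑ c ∈ Finset.univ.finsuppAntidiag n, Finsupp.single c (c.prod fun i e => w i ^ e)

/-- The image `∏ᵢ (g vᵢ)^{(a i)}` of the basis monomial `∏ᵢ vᵢ^{(a i)}` under the algebra
endomorphism of `DV` induced by the matrix `g`. -/
def actMon {K ι : Type} [Field K] [Fintype ι] [DecidableEq ι]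
    (g : Matrix ι ι K) (a : ι →₀ ℕ) : DPA K ι :=
  (a.support.toList.map fun i => dpow (fun j => g j i) (a i)).foldr
    (fun p q => dpMul K ι p q) (Finsupp.single 0 1)

/-- The algebra endomorphism of `DV` induced by the matrix `g` acting on `V` in the given
basis (for `g` invertible this is the induced algebra automorphism of `DV`). -/
def act {K ι : Type} [Field K] [Fintype ι] [DecidableEq ι] (g : Matrix ι ι K) :
    DPA K ι →ₗ[K] DPA K ι :=
  Finsupp.lsum K fun a => LinearMap.toSpanSingleton K _ (actMon g a)

/-- The entrywise square of a matrix (giving the Frobenius twist of a representation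
in characteristic 2). -/
def matSq {K ι : Type} [Field K] (g : Matrix ι ι K) : Matrix ι ι K :=
  fun i j => g i j * g i j

/-! Symplectic setting: `V` has dimension `2m` and symplectic basis `x_1,y_1,…,x_m,y_m`
indexed by `Fin m × Bool`, with `x_i = (i, false)` and `y_i = (i, true)`. -/

/-- The multi-index of the monomial `x_i y_i`. -/
def xyIdx (m : ℕ) (i : Fin m) : (Fin m × Bool) →₀ ℕ :=
  Finsupp.single (i, false) 1 + Finsupp.single (i, true) 1

/-- The element `ω = x_1 y_1 + ⋯ + x_m y_m ∈ D_2 V`. -/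
def omegaDP (K : Type) [Field K] (m : ℕ) : DPA K (Fin m × Bool) :=
  ∑ i : Fin m, Finsupp.single (xyIdx m i) (1 : K)

/-- The differential `∂` of the complex `DV`: multiplication by `ω`.  It restricts to
`∂_k : D_k V → D_{k+2} V`. -/
def del (K : Type) [Field K] (m : ℕ) :
    DPA K (Fin m × Bool) →ₗ[K] DPA K (Fin m × Bool) :=
  dpMul K (Fin m × Bool) (omegaDP K m)

/-- The matrix of the non-degenerate alternating bilinear form `f` with `f(x_i, y_j) = δᵢⱼ`,
`f(x_i, x_j) = f(y_i, y_j) = 0`. -/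
def Jmat (K : Type) [Field K] (m : ℕ) : Matrix (Fin m × Bool) (Fin m × Bool) K :=
  fun p q => if p.1 = q.1 ∧ p.2 ≠ q.2 then 1 else 0

/-- The condition that the matrix `g` belongs to the symplectic group `Sp(V)`:
`g` preserves the form `f`, i.e. `f(gu, gv) = f(u, v)` for all `u, v ∈ V`. -/
def IsSymplectic {K : Type} [Field K] {m : ℕ}
    (g : Matrix (Fin m × Bool) (Fin m × Bool) K) : Prop :=
  g.transpose * Jmat K m * g = Jmat K m

/-- The cocycles in degree `k`: `ker ∂_k = ker ∂ ∩ D_k V`. -/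
def Zmod (K : Type) [Field K] (m k : ℕ) : Submodule K (DPA K (Fin m × Bool)) :=
  LinearMap.ker (del K m) ⊓ Dsub K (Fin m × Bool) k

/-- The coboundaries in degree `k`: `Im ∂_{k-2} = ∂(D_{k-2} V)`.  (For `k = 0, 1`
truncated subtraction gives `∂(D_0 V) ⊆ D_2 V`, which meets `D_k V` only in `0`,
so no harm is done.) -/
def Bful (K : Type) [Field K] (m k : ℕ) : Submodule K (DPA K (Fin m × Bool)) :=
  Submodule.map (del K m) (Dsub K (Fin m × Bool) (k - 2))

/-- The cohomology `H^k(DV) = ker ∂_k / Im ∂_{k-2}` of the complex `DV`, realized as the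
image of `ker ∂_k` in `DV / Im ∂_{k-2}`. -/
abbrev Hcoh (K : Type) [Field K] (m k : ℕ) :=
  ↥(Submodule.map (Bful K m k).mkQ (Zmod K m k))

/-- The canonical projection `ker ∂_k → H^k(DV)`, sending a cocycle `z` to its
cohomology class `z + Im ∂_{k-2}`. -/
def toH (K : Type) [Field K] (m k : ℕ) : ↥(Zmod K m k) →ₗ[K] Hcoh K m k :=
  LinearMap.codRestrict _ ((Bful K m k).mkQ.comp (Zmod K m k).subtype)
    (fun z => Submodule.mem_map_of_mem z.2)


section Proof5

lemma xyIdx_false (m : ℕ) (i j : Fin m) :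
    xyIdx m i (j, false) = if i = j then 1 else 0 := by
  simp [xyIdx, Finsupp.single_apply]

lemma xyIdx_true (m : ℕ) (i j : Fin m) :
    xyIdx m i (j, true) = if i = j then 1 else 0 := by
  simp [xyIdx, Finsupp.single_apply]

lemma deg_eq {m : ℕ} (a : (Fin m × Bool) →₀ ℕ) :
    deg a = ∑ i : Fin m, (a (i, false) + a (i, true)) := by
  unfold deg
  rw [Finsupp.sum_fintype _ _ (fun _ => rfl), Fintype.sum_prod_type]
  refine Finset.sum_congr rfl fun i _ => ?_
  simp [add_comm]

lemma deg_add_xy {m : ℕ} (a : (Fin m × Bool) →₀ ℕ) (i : Fin m) :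
    deg (a + xyIdx m i) = deg a + 2 := by
  simp only [deg_eq, Finsupp.add_apply, xyIdx_false, xyIdx_true]
  have : ∀ j : Fin m, a (j, false) + (if i = j then 1 else 0) + (a (j, true) + if i = j then 1 else 0)
      = (a (j, false) + a (j, true)) + (if i = j then 2 else 0) := by
    intro j; split_ifs <;> ring
  simp [this, Finset.sum_add_distrib]

lemma dpCoef_xy {m : ℕ} (a : (Fin m × Bool) →₀ ℕ) (i : Fin m) :
    dpCoef (xyIdx m i) a = (a (i, false) + 1) * (a (i, true) + 1) := by
  unfold dpCoef
  rw [Finsupp.prod, Finset.prod_subset (Finset.subset_univ _), Fintype.prod_prod_type]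
  · rw [Finset.prod_eq_single i]
    · simp [xyIdx_false, xyIdx_true, add_comm, mul_comm]
    · intro j _ hj
      simp [xyIdx_false, xyIdx_true, Ne.symm hj]
    · simp
  · intro j _ hj
    rw [Finsupp.notMem_support_iff, Finsupp.add_apply] at hj
    rw [Nat.add_eq_zero_iff] at hj
    simp [hj.1, hj.2]

/-- both exponents even -/
def EE {m : ℕ} (a : (Fin m × Bool) →₀ ℕ) (i : Fin m) : Prop :=
  a (i, false) % 2 = 0 ∧ a (i, true) % 2 = 0

/-- both exponents odd -/
def OO {m : ℕ} (a : (Fin m × Bool) →₀ ℕ) (i : Fin m) : Prop :=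
  a (i, false) % 2 = 1 ∧ a (i, true) % 2 = 1

/-- same parity -/
def Ev {m : ℕ} (a : (Fin m × Bool) →₀ ℕ) (i : Fin m) : Prop :=
  a (i, false) % 2 = a (i, true) % 2

lemma Ev_add {m : ℕ} (a : (Fin m × Bool) →₀ ℕ) (j : Fin m) : Ev (a + xyIdx m j) = Ev a := by
  funext i
  simp only [Ev, Finsupp.add_apply, xyIdx_false, xyIdx_true, eq_iff_iff]
  split_ifs <;> omega

open Classical in
lemma del_single (K : Type) [Field K] [CharP K 2] (m : ℕ) (a : (Fin m × Bool) →₀ ℕ) :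
    del K m (Finsupp.single a 1) =
      ∑ i : Fin m, if EE a i then Finsupp.single (a + xyIdx m i) (1 : K) else 0 := by
  simp only [del, omegaDP, map_sum, LinearMap.sum_apply]
  refine Finset.sum_congr rfl fun i _ => ?_
  have h1 : dpMul K _ (Finsupp.single (xyIdx m i) 1) (Finsupp.single a 1)
      = (dpCoef (xyIdx m i) a : K) • Finsupp.single (xyIdx m i + a) (1 : K) := by
    simp [dpMul]
  rw [h1, dpCoef_xy, add_comm (xyIdx m i) a]
  split_ifs with h
  · have : (((a (i, false) + 1) * (a (i, true) + 1) : ℕ) : K) = 1 := by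
      have h2 : ((a (i, false) + 1) * (a (i, true) + 1)) % 2 = 1 := by
        obtain ⟨h3, h4⟩ := h
        rw [Nat.mul_mod, show (a (i, false) + 1) % 2 = 1 by omega,
          show (a (i, true) + 1) % 2 = 1 by omega]
      rw [CharP.cast_eq_mod K 2, h2]; simp
    rw [this, one_smul]
  · have : (((a (i, false) + 1) * (a (i, true) + 1) : ℕ) : K) = 0 := by
      rw [CharP.cast_eq_zero_iff K 2]
      by_cases h3 : a (i, false) % 2 = 0
      · have h4 : ¬ a (i, true) % 2 = 0 := fun h4 => h ⟨h3, h4⟩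
        exact Dvd.dvd.mul_left (by omega) _
      · exact Dvd.dvd.mul_right (by omega) _
    rw [this, zero_smul]

open Classical in
/-- homotopy on monomials -/
def hmon (K : Type) [Field K] (m : ℕ) [Nonempty (Fin m)] (a : (Fin m × Bool) →₀ ℕ) :
    DPA K (Fin m × Bool) :=
  if OO a (Classical.epsilon (Ev a)) then
    Finsupp.single (a - xyIdx m (Classical.epsilon (Ev a))) 1 else 0

/-- homotopy -/
def hmap (K : Type) [Field K] (m : ℕ) [Nonempty (Fin m)] :
    DPA K (Fin m × Bool) →ₗ[K] DPA K (Fin m × Bool) :=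
  Finsupp.lsum K fun a => LinearMap.toSpanSingleton K _ (hmon K m a)

lemma hmap_single (K : Type) [Field K] (m : ℕ) [Nonempty (Fin m)] (a : (Fin m × Bool) →₀ ℕ) :
    hmap K m (Finsupp.single a 1) = hmon K m a := by
  simp [hmap]

lemma OO_le {m : ℕ} {a : (Fin m × Bool) →₀ ℕ} {i : Fin m} (h : OO a i) : xyIdx m i ≤ a := by
  rintro ⟨j, b⟩
  obtain ⟨h1, h2⟩ := h
  cases b
  · rw [xyIdx_false]; split_ifs with e
    · subst e; omega
    · omega
  · rw [xyIdx_true]; split_ifs with e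
    · subst e; omega
    · omega

lemma EE_add_ne {m : ℕ} {a : (Fin m × Bool) →₀ ℕ} {i j : Fin m} (h : i ≠ j) :
    EE (a + xyIdx m i) j ↔ EE a j := by
  simp [EE, xyIdx_false, xyIdx_true, h]

lemma OO_add_ne {m : ℕ} {a : (Fin m × Bool) →₀ ℕ} {i j : Fin m} (h : i ≠ j) :
    OO (a + xyIdx m i) j ↔ OO a j := by
  simp [OO, xyIdx_false, xyIdx_true, h]

lemma OO_add_self {m : ℕ} {a : (Fin m × Bool) →₀ ℕ} {i : Fin m} :
    OO (a + xyIdx m i) i ↔ EE a i := by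
  simp only [OO, EE, Finsupp.add_apply, xyIdx_false, xyIdx_true, if_true]
  omega

lemma homotopy (K : Type) [Field K] [CharP K 2] (m : ℕ) [Nonempty (Fin m)]
    (a : (Fin m × Bool) →₀ ℕ) (ha : ∃ i, Ev a i) :
    del K m (hmap K m (Finsupp.single a 1)) + hmap K m (del K m (Finsupp.single a 1))
      = Finsupp.single a 1 := by
  classical
  have hi := Classical.epsilon_spec ha
  rw [hmap_single, del_single, map_sum]
  simp only [apply_ite (hmap K m), hmap_single, map_zero]
  simp only [hmon, Ev_add]
  generalize Classical.epsilon (Ev a) = i at hi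
  by_cases ho : OO a i
  · obtain ⟨b, rfl⟩ := exists_add_of_le (OO_le ho)
    rw [add_comm (xyIdx m i) b] at *
    have hb : EE b i := OO_add_self.1 ho
    rw [if_pos ho, add_tsub_cancel_right, del_single,
      ← Finset.add_sum_erase _ _ (Finset.mem_univ i),
      ← Finset.add_sum_erase (f := fun x => if EE (b + xyIdx m i) x then _ else _) _ (Finset.mem_univ i)]
    have hne : ¬ EE (b + xyIdx m i) i := fun h => by
      have := h.1; have := ho.1; omega
    rw [if_pos hb, if_neg hne, zero_add, add_assoc, ← Finset.sum_add_distrib,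
      Finset.sum_eq_zero, add_zero]
    intro j hj
    have hj : j ≠ i := (Finset.mem_erase.1 hj).1
    rw [OO_add_ne hj, if_pos ho, EE_add_ne hj.symm, add_right_comm, add_tsub_cancel_right]
    split_ifs
    · rw [← Finsupp.single_add, CharTwo.add_self_eq_zero, Finsupp.single_zero]
    · simp
  · have he : EE a i := by
      simp only [OO, EE, Ev] at *; omega
    rw [if_neg ho, map_zero, zero_add, Finset.sum_eq_single i]
    · rw [if_pos he, if_pos (OO_add_self.2 he), add_tsub_cancel_right]
    · intro j _ hj
      rw [OO_add_ne hj, if_neg ho, ite_self]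
    · simp

lemma hmap_mem (K : Type) [Field K] (m : ℕ) [Nonempty (Fin m)] (k : ℕ)
    (z : DPA K (Fin m × Bool)) (hz : z ∈ Dsub K (Fin m × Bool) k) :
    hmap K m z ∈ Dsub K (Fin m × Bool) (k - 2) := by
  suffices h : Dsub K (Fin m × Bool) k ≤ (Dsub K (Fin m × Bool) (k - 2)).comap (hmap K m) from h hz
  refine Submodule.span_le.2 ?_
  rintro _ ⟨a, rfl, rfl⟩
  simp only [Submodule.comap_coe, Set.mem_preimage, SetLike.mem_coe, hmap_single, hmon]
  split_ifs with h
  · refine Submodule.subset_span ⟨_, ?_, rfl⟩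
    generalize Classical.epsilon (Ev a) = i at h
    obtain ⟨b, rfl⟩ := exists_add_of_le (OO_le h)
    rw [add_comm, deg_add_xy]; simp
  · exact zero_mem _

lemma exists_Ev {m k : ℕ} (hk : k < m ∨ ¬ k % 2 = m % 2) (a : (Fin m × Bool) →₀ ℕ)
    (ha : deg a = k) : ∃ i, Ev a i := by
  by_contra! hc
  have h1 : ∀ i, (a (i, false) + a (i, true)) % 2 = 1 := fun i => by
    have := hc i; simp only [Ev] at this; omega
  rw [deg_eq] at ha
  rcases hk with hk | hk
  · have : ∑ i : Fin m, 1 ≤ ∑ i : Fin m, (a (i, false) + a (i, true)) :=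
      Finset.sum_le_sum fun i _ => by have := h1 i; omega
    simp at this; omega
  · apply hk
    rw [← ha, Finset.sum_nat_mod]
    simp [h1]

lemma subsing_iff (K : Type) [Field K] (m k : ℕ) :
    Subsingleton (Hcoh K m k) ↔ Zmod K m k ≤ Bful K m k := by
  rw [Submodule.subsingleton_iff_eq_bot, ← le_bot_iff, Submodule.map_le_iff_le_comap,
    Submodule.comap_bot, Submodule.ker_mkQ]

/-- witness cocycle monomial -/
def witn (m k : ℕ) (i₀ : Fin m) : (Fin m × Bool) →₀ ℕ :=
  Finsupp.equivFunOnFinite.symm fun p =>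
    if p.2 = true then 0 else 1 + if p.1 = i₀ then k - m else 0

end Proof5

/-- `H^k(DV) = 0` if and only if `k < m` or `k ≢ m (mod 2)`. -/
theorem statement_5 (K : Type) [Field K] [CharP K 2] (m : ℕ) (hm : 1 ≤ m) (k : ℕ) :
    Subsingleton (Hcoh K m k) ↔ (k < m ∨ ¬ k % 2 = m % 2) := by
  classical
  have i₀ : Fin m := ⟨0, hm⟩
  have : Nonempty (Fin m) := ⟨i₀⟩
  rw [subsing_iff]
  constructor
  · intro hle
    by_contra! hk
    obtain ⟨hk1, hk2⟩ := hk
    have hf : ∀ i, witn m k i₀ (i, false) = 1 + if i = i₀ then k - m else 0 := fun i => by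
      simp [witn]
    have ht : ∀ i, witn m k i₀ (i, true) = 0 := fun i => by simp [witn]
    have hz : Finsupp.single (witn m k i₀) (1 : K) ∈ Zmod K m k := by
      refine ⟨?_, Submodule.subset_span ⟨_, ?_, rfl⟩⟩
      · rw [SetLike.mem_coe, LinearMap.mem_ker, del_single]
        refine Finset.sum_eq_zero fun i _ => if_neg fun h => ?_
        have := h.1
        rw [hf] at this
        split_ifs at this <;> omega
      · rw [deg_eq]
        simp only [hf, ht, add_zero, Finset.sum_add_distrib]
        simp; omega
    obtain ⟨f, -, hfe⟩ := hle hz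
    have key : ∀ f, del K m f (witn m k i₀) = 0 := by
      intro f
      induction f using Finsupp.induction_linear with
      | zero => simp
      | add f g hf hg => simp [hf, hg]
      | single a c =>
        rw [show Finsupp.single a c = c • Finsupp.single a (1 : K) by simp, map_smul, del_single,
          Finsupp.smul_apply, Finsupp.finsetSum_apply, Finset.sum_eq_zero, smul_zero]
        intro i _
        split_ifs
        · rw [Finsupp.single_apply, if_neg]
          intro h
          have := DFunLike.congr_fun h (i, true)
          rw [ht] at this
          simp [xyIdx_true] at this
        · rfl
    have := key f
    rw [hfe] at this
    simp at this
  · rintro hk z ⟨hz1, hz2⟩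
    refine ⟨hmap K m z, hmap_mem K m k z hz2, ?_⟩
    have : Dsub K (Fin m × Bool) k ≤
        LinearMap.eqLocus ((del K m) ∘ₗ (hmap K m) + (hmap K m) ∘ₗ (del K m)) LinearMap.id := by
      refine Submodule.span_le.2 ?_
      rintro _ ⟨a, ha, rfl⟩
      exact homotopy K m a (exists_Ev hk a ha)
    have h2 := this hz2
    rw [LinearMap.mem_eqLocus] at h2
    have hz1 : del K m z = 0 := hz1
    simpa [hz1] using h2
end
end

section
/- Let K be a field of characteristic 2, V a K-vector space of dimension n with basis {v_1, ..., v_n}, k ≥ 0, and let N ⊆ D_{2k}V be the span of the monomials v_1^{(a_1)}···v_n^{(a_n)} (Σa_i = 2k) having at least one odd exponent. Let (D_kV)^{(1)} denote the Frobenius twist of D_kV: the same vector space with SL(n, K)-action in which g acts as the matrix g^{[2]} obtained from g by squaring every entry. Then the linear map φ: (D_kV)^{(1)} → D_{2k}V/N sending v_1^{(b_1)}···v_n^{(b_n)} to v_1^{(2b_1)}···v_n^{(2b_n)} + N is an isomorphism of SL(n, K)-modules. -/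
noncomputable section

open Finsupp TensorProduct

/-- The subspace `N` of `D_{2k}V` spanned by the monomials `v_1^{(a_1)} ⋯ v_n^{(a_n)}`,
`a_1 + ⋯ + a_n = 2k`, in which at least one exponent `a_i` is odd. -/
def Nodd (K ι : Type) [Field K] (k : ℕ) : Submodule K (DPA K ι) :=
  Submodule.span K {f | ∃ a : ι →₀ ℕ, deg a = 2 * k ∧ (∃ i, Odd (a i)) ∧
    f = Finsupp.single a (1 : K)}

lemma dbl_inj {ι : Type} : Function.Injective (fun a : ι →₀ ℕ => a + a) := by
  intro a b h
  ext i
  have := DFunLike.congr_fun h i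
  simp only [Finsupp.add_apply] at this
  omega

/-- Halving map. -/
def hlv (K ι : Type) [Field K] : DPA K ι →ₗ[K] DPA K ι :=
  Finsupp.lcomapDomain (fun a : ι →₀ ℕ => a + a) dbl_inj

/-- Doubling map. -/
def dbl (K ι : Type) [Field K] : DPA K ι →ₗ[K] DPA K ι :=
  Finsupp.lmapDomain K K (fun a : ι →₀ ℕ => a + a)

lemma hlv_apply {K ι : Type} [Field K] (f : DPA K ι) (a : ι →₀ ℕ) :
    hlv K ι f a = f (a + a) := rfl

lemma hlv_single_dbl {K ι : Type} [Field K] (a : ι →₀ ℕ) (r : K) :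
    hlv K ι (Finsupp.single (a + a) r) = Finsupp.single a r := by
  classical
  ext c
  rw [hlv_apply, Finsupp.single_apply, Finsupp.single_apply]
  by_cases h : a = c
  · simp [h]
  · rw [if_neg h, if_neg (fun h' => h (dbl_inj h'))]

lemma hlv_single_odd {K ι : Type} [Field K] (a : ι →₀ ℕ) (i : ι) (hi : Odd (a i)) (r : K) :
    hlv K ι (Finsupp.single a r) = 0 := by
  classical
  ext c
  rw [hlv_apply, Finsupp.single_apply, if_neg]
  · rfl
  · rintro rfl
    rw [Finsupp.add_apply] at hi
    obtain ⟨m, hm⟩ := hi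
    omega

lemma even_or_odd_idx {ι : Type} (a : ι →₀ ℕ) : (∃ b, a = b + b) ∨ ∃ i, Odd (a i) := by
  by_cases h : ∃ i, Odd (a i)
  · exact Or.inr h
  · left
    refine ⟨a.mapRange (fun x => x / 2) (by norm_num), ?_⟩
    ext i
    have : ¬ Odd (a i) := fun hh => h ⟨i, hh⟩
    rw [Nat.not_odd_iff_even] at this
    obtain ⟨m, hm⟩ := this
    simp only [Finsupp.add_apply, Finsupp.mapRange_apply]
    omega

lemma hlv_dbl {K ι : Type} [Field K] (f : DPA K ι) : hlv K ι (dbl K ι f) = f := by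
  ext c
  rw [hlv_apply]
  exact Finsupp.mapDomain_apply dbl_inj f c

lemma dpMul_single {K ι : Type} [Field K] (a b : ι →₀ ℕ) (r s : K) :
    dpMul K ι (Finsupp.single a r) (Finsupp.single b s)
      = Finsupp.single (a + b) (r * s * (dpCoef a b : K)) := by
  unfold dpMul
  rw [Finsupp.lsum_single, LinearMap.toSpanSingleton_apply, LinearMap.smul_apply,
    Finsupp.lsum_single, LinearMap.toSpanSingleton_apply, Finsupp.smul_single,
    Finsupp.smul_single, Finsupp.smul_single, smul_eq_mul, smul_eq_mul, smul_eq_mul, mul_one,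
    mul_assoc]

lemma choose_two_two (m l : ℕ) : ((2 * m).choose (2 * l)) ≡ m.choose l [MOD 2] := by
  have : Fact (Nat.Prime 2) := ⟨Nat.prime_two⟩
  have := Choose.choose_modEq_choose_mod_mul_choose_div_nat (n := 2 * m) (k := 2 * l) (p := 2)
  simpa using this

lemma choose_even_odd (m l : ℕ) (hm : Even m) (hl : Odd l) : (m.choose l) ≡ 0 [MOD 2] := by
  have : Fact (Nat.Prime 2) := ⟨Nat.prime_two⟩
  have := Choose.choose_modEq_choose_mod_mul_choose_div_nat (n := m) (k := l) (p := 2)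
  rw [Nat.even_iff.mp hm, Nat.odd_iff.mp hl] at this
  simpa using this

lemma cast_modEq {K : Type} [Field K] [CharP K 2] {a b : ℕ} (h : a ≡ b [MOD 2]) :
    (a : K) = b := (CharP.natCast_eq_natCast K 2).mpr h

lemma support_dbl {ι : Type} (a : ι →₀ ℕ) : (a + a).support = a.support := by
  ext i
  simp

lemma dpCoef_dbl {K ι : Type} [Field K] [CharP K 2] (a b : ι →₀ ℕ) :
    (dpCoef (a + a) (b + b) : K) = dpCoef a b := by
  unfold dpCoef Finsupp.prod
  have h : (a + a + (b + b)).support = (a + b).support := by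
    rw [← support_dbl (a + b)]
    congr 1
    abel
  rw [h, Nat.cast_prod, Nat.cast_prod]
  refine Finset.prod_congr rfl fun i _ => ?_
  apply cast_modEq
  have := choose_two_two (a i + b i) (a i)
  simp only [Finsupp.add_apply]
  convert this using 2 <;> ring

lemma dpCoef_odd {K ι : Type} [Field K] [CharP K 2] (a b : ι →₀ ℕ) (i : ι)
    (hi : Odd (a i)) (h : Even (a i + b i)) : (dpCoef a b : K) = 0 := by
  unfold dpCoef Finsupp.prod
  rw [Nat.cast_prod]
  apply Finset.prod_eq_zero (i := i)
  · rw [Finsupp.mem_support_iff, Finsupp.add_apply]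
    obtain ⟨m, hm⟩ := hi
    omega
  · have := cast_modEq (K := K) (choose_even_odd _ _ h hi)
    simpa using this

lemma hlv_mul_single {K ι : Type} [Field K] [CharP K 2] (a b : ι →₀ ℕ) (r s : K) :
    hlv K ι (dpMul K ι (Finsupp.single a r) (Finsupp.single b s))
      = dpMul K ι (hlv K ι (Finsupp.single a r)) (hlv K ι (Finsupp.single b s)) := by
  rw [dpMul_single]
  rcases even_or_odd_idx a with ⟨a, rfl⟩ | ⟨i, hi⟩
  · rcases even_or_odd_idx b with ⟨b, rfl⟩ | ⟨i, hi⟩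
    · rw [hlv_single_dbl, hlv_single_dbl, dpMul_single, dpCoef_dbl,
        show a + a + (b + b) = (a + b) + (a + b) by abel, hlv_single_dbl]
    · rw [hlv_single_odd b i hi, map_zero, hlv_single_odd _ i]
      rw [Finsupp.add_apply, Finsupp.add_apply]
      exact Even.add_odd ⟨_, rfl⟩ hi
  · rw [hlv_single_odd a i hi, map_zero, LinearMap.zero_apply]
    rcases Nat.even_or_odd (a i + b i) with h | h
    · rw [dpCoef_odd a b i hi h]
      simp
    · exact hlv_single_odd _ i h _

lemma hlv_mul {K ι : Type} [Field K] [CharP K 2] (p q : DPA K ι) :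
    hlv K ι (dpMul K ι p q) = dpMul K ι (hlv K ι p) (hlv K ι q) := by
  induction p using Finsupp.induction_linear with
  | zero => simp
  | add p p' h h' => simp only [map_add, LinearMap.add_apply, h, h']
  | single a r =>
    induction q using Finsupp.induction_linear with
    | zero => simp
    | add p p' h h' => simp only [map_add, h, h']
    | single b s => exact hlv_mul_single a b r s

lemma dpow_apply {K ι : Type} [Field K] [Fintype ι] [DecidableEq ι] (w : ι → K) (n : ℕ)
    (c : ι →₀ ℕ) : dpow w n c = if deg c = n then (∏ i, w i ^ c i) else 0 := by
  unfold dpow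
  rw [Finsupp.finsetSum_apply]
  simp only [Finsupp.single_apply]
  rw [Finset.sum_ite_eq']
  have h1 : c ∈ Finset.univ.finsuppAntidiag n ↔ deg c = n := by
    rw [Finset.mem_finsuppAntidiag]
    simp [deg, Finsupp.sum_fintype]
  simp only [h1]
  rw [Finsupp.prod_fintype _ _ (by simp)]

lemma deg_add {ι : Type} (a b : ι →₀ ℕ) : deg (a + b) = deg a + deg b := by
  unfold deg
  exact Finsupp.sum_add_index' (by simp) (by simp)

lemma hlv_dpow_even {K ι : Type} [Field K] [Fintype ι] [DecidableEq ι] (w : ι → K) (n : ℕ) :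
    hlv K ι (dpow w (n + n)) = dpow (fun j => w j * w j) n := by
  ext c
  rw [hlv_apply, dpow_apply, dpow_apply, deg_add]
  have : deg c + deg c = n + n ↔ deg c = n := by omega
  simp only [this, Finsupp.add_apply, pow_add, mul_pow]

lemma hlv_dpow_odd {K ι : Type} [Field K] [Fintype ι] [DecidableEq ι] (w : ι → K) (n : ℕ)
    (hn : Odd n) : hlv K ι (dpow w n) = 0 := by
  ext c
  rw [hlv_apply, dpow_apply, deg_add, if_neg]
  · rfl
  · obtain ⟨m, hm⟩ := hn
    omega

lemma hlv_fold {K ι : Type} [Field K] [CharP K 2] (f : ι → DPA K ι) (l : List ι) :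
    hlv K ι ((l.map f).foldr (fun p q => dpMul K ι p q) (Finsupp.single 0 1))
      = (l.map fun i => hlv K ι (f i)).foldr (fun p q => dpMul K ι p q) (Finsupp.single 0 1) := by
  induction l with
  | nil => simpa using hlv_single_dbl (0 : ι →₀ ℕ) (1 : K)
  | cons a l ih => simp only [List.map_cons, List.foldr_cons, hlv_mul, ih]

lemma fold_zero {K ι : Type} [Field K] (f : ι → DPA K ι) (l : List ι) (i : ι) (hi : i ∈ l)
    (h : f i = 0) :
    (l.map f).foldr (fun p q => dpMul K ι p q) (Finsupp.single 0 1) = 0 := by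
  induction l with
  | nil => simp at hi
  | cons a l ih =>
    simp only [List.map_cons, List.foldr_cons]
    rcases List.mem_cons.mp hi with rfl | hi
    · rw [h, map_zero, LinearMap.zero_apply]
    · rw [ih hi, map_zero]

lemma hlv_actMon_dbl {K ι : Type} [Field K] [CharP K 2] [Fintype ι] [DecidableEq ι]
    (g : Matrix ι ι K) (a : ι →₀ ℕ) :
    hlv K ι (actMon g (a + a)) = actMon (matSq g) a := by
  unfold actMon
  rw [hlv_fold, support_dbl]
  simp only [Finsupp.add_apply, hlv_dpow_even]
  rfl

lemma hlv_actMon_odd {K ι : Type} [Field K] [CharP K 2] [Fintype ι] [DecidableEq ι]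
    (g : Matrix ι ι K) (a : ι →₀ ℕ) (i : ι) (hi : Odd (a i)) :
    hlv K ι (actMon g a) = 0 := by
  unfold actMon
  rw [hlv_fold]
  apply fold_zero _ _ i
  · rw [Finset.mem_toList, Finsupp.mem_support_iff]
    rintro h
    rw [h] at hi
    exact absurd hi (by decide)
  · exact hlv_dpow_odd _ _ hi

lemma act_single {K ι : Type} [Field K] [Fintype ι] [DecidableEq ι]
    (g : Matrix ι ι K) (a : ι →₀ ℕ) (r : K) :
    act g (Finsupp.single a r) = r • actMon g a := by
  simp [act]

lemma hlv_act {K ι : Type} [Field K] [CharP K 2] [Fintype ι] [DecidableEq ι]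
    (g : Matrix ι ι K) (p : DPA K ι) :
    hlv K ι (act g p) = act (matSq g) (hlv K ι p) := by
  induction p using Finsupp.induction_linear with
  | zero => simp
  | add p p' h h' => simp only [map_add, h, h']
  | single a r =>
    rw [act_single, map_smul]
    rcases even_or_odd_idx a with ⟨a, rfl⟩ | ⟨i, hi⟩
    · rw [hlv_single_dbl, act_single, hlv_actMon_dbl]
    · rw [hlv_single_odd a i hi, hlv_actMon_odd g a i hi, map_zero, smul_zero]

lemma mem_Dsub {K ι : Type} [Field K] {k : ℕ} {f : DPA K ι} :
    f ∈ Dsub K ι k ↔ ∀ c, deg c ≠ k → f c = 0 := by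
  have : Dsub K ι k = Finsupp.supported K K {a | deg a = k} := by
    rw [Finsupp.supported_eq_span_single]
    unfold Dsub
    congr 1
    ext f
    constructor
    · rintro ⟨a, h, rfl⟩
      exact ⟨a, h, rfl⟩
    · rintro ⟨a, h, rfl⟩
      exact ⟨a, h, rfl⟩
  rw [this, Finsupp.mem_supported']
  rfl

lemma mem_Nodd {K ι : Type} [Field K] {k : ℕ} {f : DPA K ι} :
    f ∈ Nodd K ι k ↔ f ∈ Dsub K ι (2 * k) ∧ hlv K ι f = 0 := by
  have : Nodd K ι k = Finsupp.supported K K {a | deg a = 2 * k ∧ ∃ i, Odd (a i)} := by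
    rw [Finsupp.supported_eq_span_single]
    unfold Nodd
    congr 1
    ext f
    constructor
    · rintro ⟨a, h, h', rfl⟩
      exact ⟨a, ⟨h, h'⟩, rfl⟩
    · rintro ⟨a, ⟨h, h'⟩, rfl⟩
      exact ⟨a, h, h', rfl⟩
  rw [this, Finsupp.mem_supported', mem_Dsub]
  constructor
  · intro h
    refine ⟨fun c hc => h c (fun h' => hc h'.1), ?_⟩
    ext c
    rw [hlv_apply]
    apply h
    rintro ⟨_, i, hi⟩
    rw [Finsupp.add_apply] at hi
    obtain ⟨m, hm⟩ := hi
    omega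
  · rintro ⟨h1, h2⟩ c hc
    by_cases hd : deg c = 2 * k
    · rcases even_or_odd_idx c with ⟨a, rfl⟩ | h
      · rw [← hlv_apply, h2]
        rfl
      · exact absurd ⟨hd, h⟩ hc
    · exact h1 c hd

lemma single_mem_Dsub {K ι : Type} [Field K] (a : ι →₀ ℕ) (r : K) :
    Finsupp.single a r ∈ Dsub K ι (deg a) := by
  classical
  rw [mem_Dsub]
  intro c hc
  rw [Finsupp.single_apply, if_neg]
  rintro rfl
  exact hc rfl

lemma Dsub_le {K ι : Type} [Field K] {k : ℕ} {P : Submodule K (DPA K ι)}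
    (h : ∀ a, deg a = k → Finsupp.single a (1 : K) ∈ P) : Dsub K ι k ≤ P := by
  unfold Dsub
  rw [Submodule.span_le]
  rintro f ⟨a, ha, rfl⟩
  exact h a ha

lemma dpMul_mem {K ι : Type} [Field K] {k l : ℕ} {p q : DPA K ι}
    (hp : p ∈ Dsub K ι k) (hq : q ∈ Dsub K ι l) : dpMul K ι p q ∈ Dsub K ι (k + l) := by
  have h1 : ∀ a, deg a = k → Dsub K ι l ≤
      (Dsub K ι (k + l)).comap (dpMul K ι (Finsupp.single a 1)) := by
    intro a ha
    refine Dsub_le fun b hb => ?_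
    rw [Submodule.mem_comap, dpMul_single, ← ha, ← hb, ← deg_add]
    exact single_mem_Dsub _ _
  have h2 : Dsub K ι k ≤ (Dsub K ι (k + l)).comap ((dpMul K ι).flip q) :=
    Dsub_le fun a ha => h1 a ha hq
  exact h2 hp

lemma dpow_mem {K ι : Type} [Field K] [Fintype ι] [DecidableEq ι] (w : ι → K) (n : ℕ) :
    dpow w n ∈ Dsub K ι n := by
  rw [mem_Dsub]
  intro c hc
  rw [dpow_apply, if_neg hc]

lemma actMon_mem {K ι : Type} [Field K] [Fintype ι] [DecidableEq ι]
    (g : Matrix ι ι K) (a : ι →₀ ℕ) : actMon g a ∈ Dsub K ι (deg a) := by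
  have key : ∀ l : List ι,
      (l.map fun i => dpow (fun j => g j i) (a i)).foldr
        (fun p q => dpMul K ι p q) (Finsupp.single 0 1) ∈ Dsub K ι (l.map a).sum := by
    intro l
    induction l with
    | nil => simpa [deg] using single_mem_Dsub (0 : ι →₀ ℕ) (1 : K)
    | cons i l ih =>
      simp only [List.map_cons, List.foldr_cons, List.sum_cons]
      exact dpMul_mem (dpow_mem _ _) ih
  have := key a.support.toList
  rw [Finset.sum_map_toList] at this
  exact this

lemma act_mem {K ι : Type} [Field K] [Fintype ι] [DecidableEq ι]
    (g : Matrix ι ι K) {k : ℕ} {p : DPA K ι} (hp : p ∈ Dsub K ι k) : act g p ∈ Dsub K ι k := by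
  have : Dsub K ι k ≤ (Dsub K ι k).comap (act g) := by
    refine Dsub_le fun a ha => ?_
    rw [Submodule.mem_comap, act_single, one_smul, ← ha]
    exact actMon_mem g a
  exact this hp

lemma dbl_single {K ι : Type} [Field K] (a : ι →₀ ℕ) (r : K) :
    dbl K ι (Finsupp.single a r) = Finsupp.single (a + a) r :=
  Finsupp.mapDomain_single

lemma dbl_mem {K ι : Type} [Field K] {k : ℕ} {p : DPA K ι} (hp : p ∈ Dsub K ι k) :
    dbl K ι p ∈ Dsub K ι (2 * k) := by
  have : Dsub K ι k ≤ (Dsub K ι (2 * k)).comap (dbl K ι) := by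
    refine Dsub_le fun a ha => ?_
    rw [Submodule.mem_comap, dbl_single, ← ha, two_mul, ← deg_add]
    exact single_mem_Dsub _ _
  exact this hp

lemma hlv_mem {K ι : Type} [Field K] {k : ℕ} {p : DPA K ι} (hp : p ∈ Dsub K ι (2 * k)) :
    hlv K ι p ∈ Dsub K ι k := by
  rw [mem_Dsub] at hp ⊢
  intro c hc
  rw [hlv_apply]
  apply hp
  rw [deg_add]
  omega

lemma mkQ_eq {K ι : Type} [Field K] {k : ℕ} {p q : DPA K ι} :
    (Nodd K ι k).mkQ p = (Nodd K ι k).mkQ q ↔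
      p - q ∈ Dsub K ι (2 * k) ∧ hlv K ι p = hlv K ι q := by
  rw [Submodule.mkQ_apply, Submodule.mkQ_apply, Submodule.Quotient.eq, mem_Nodd, map_sub,
    sub_eq_zero]

/-- The map `φ : (D_k V)^{(1)} → D_{2k}V / N` sending
`v_1^{(b_1)} ⋯ v_n^{(b_n)}` to `v_1^{(2b_1)} ⋯ v_n^{(2b_n)} + N` is an isomorphism of
`SL(n, K)`-modules, where the Frobenius twist `(D_k V)^{(1)}` carries the action in which
`g` acts through the entrywise square `g^{[2]}`.  (Here `D_{2k}V / N` is realized as the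
image of `D_{2k}V` in `DV / N`.) -/
theorem statement_11 (K : Type) [Field K] [CharP K 2] (n k : ℕ) :
    ∃ φ : ↥(Dsub K (Fin n) k) →ₗ[K]
        ↥(Submodule.map (Nodd K (Fin n) k).mkQ (Dsub K (Fin n) (2 * k))),
      Function.Bijective φ ∧
      (∀ (a : Fin n →₀ ℕ) (_ : deg a = k)
        (h1 : Finsupp.single a (1 : K) ∈ Dsub K (Fin n) k),
        (φ ⟨Finsupp.single a 1, h1⟩ : DPA K (Fin n) ⧸ Nodd K (Fin n) k)
          = (Nodd K (Fin n) k).mkQ (Finsupp.single (a + a) 1)) ∧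
      (∀ g : Matrix (Fin n) (Fin n) K, g.det = 1 →
        ∀ (u u' : ↥(Dsub K (Fin n) k)) (p q : DPA K (Fin n)),
          (u' : DPA K (Fin n)) = act (matSq g) ↑u →
          (φ u : DPA K (Fin n) ⧸ Nodd K (Fin n) k) = (Nodd K (Fin n) k).mkQ p →
          q = act g p →
          (φ u' : DPA K (Fin n) ⧸ Nodd K (Fin n) k) = (Nodd K (Fin n) k).mkQ q) := by
  let φ : ↥(Dsub K (Fin n) k) →ₗ[K]
        ↥(Submodule.map (Nodd K (Fin n) k).mkQ (Dsub K (Fin n) (2 * k))) :=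
    LinearMap.codRestrict _
      (((Nodd K (Fin n) k).mkQ.comp (dbl K (Fin n))).comp (Dsub K (Fin n) k).subtype)
      (fun z => Submodule.mem_map_of_mem (dbl_mem z.2))
  have hφ : ∀ u, (φ u : DPA K (Fin n) ⧸ Nodd K (Fin n) k)
      = (Nodd K (Fin n) k).mkQ (dbl K (Fin n) u) := fun u => rfl
  refine ⟨φ, ⟨?_, ?_⟩, ?_, ?_⟩
  · intro u v h
    have h' := congrArg Subtype.val h
    rw [hφ, hφ, mkQ_eq, hlv_dbl, hlv_dbl] at h'
    exact Subtype.ext h'.2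
  · rintro ⟨x, p, hp, rfl⟩
    refine ⟨⟨hlv K (Fin n) p, hlv_mem hp⟩, Subtype.ext ?_⟩
    rw [hφ, mkQ_eq]
    exact ⟨Submodule.sub_mem _ (dbl_mem (hlv_mem hp)) hp, hlv_dbl _⟩
  · intro a _ h1
    rw [hφ, dbl_single]
  · intro g _ u u' p q hu' hp hq
    rw [hφ, mkQ_eq, hlv_dbl] at hp
    have hpD : p ∈ Dsub K (Fin n) (2 * k) := by
      have := Submodule.sub_mem _ (dbl_mem u.2) hp.1
      rwa [sub_sub_cancel] at this
    rw [hφ, mkQ_eq, hlv_dbl, hq, hlv_act, ← hp.2]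
    exact ⟨Submodule.sub_mem _ (dbl_mem u'.2) (act_mem g hpD), hu'⟩
end
end
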